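/- Let (D, ⊑_D) be an ω-cpo with least element ⊥_D, let base : F_0 ∪ K → D, and for each n > 0 with F_n ≠ ∅ let ind_n : F_n → (Dⁿ → D) map into ω-continuous functions. Then the coinductively defined function h := ⊔_{i≥0} h_i : Tree^∞(F,K) → D satisfies h(↺) = ⊥_D and is ω-continuous with respect to ⊑_T and ⊑_D: it is monotone and, for every ω-chain (t_i)_{i∈ℕ} of trees, h(⊔_i t_i) = ⊔_i h(t_i). -/

import Mathlib

abbrev Pos := List ℕ

inductive Label (F : Type) (K : Type) where
  | sym (f : F)
  | var (k : K)
  | loop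

def Label.arity {F K : Type} (ar : F → ℕ) : Label F K → ℕ
  | .sym f => ar f
  | .var _ => 0
  | .loop => 0

/-- A possibly-infinite tree, as a partial map from positions to labels. -/
abbrev PTree (F K : Type) := Pos → Option (Label F K)

def IsTree {F K : Type} (ar : F → ℕ) (t : PTree F K) : Prop :=
  t [] ≠ none ∧
  (∀ (p : Pos) (j : ℕ), t (p ++ [j]) ≠ none → t p ≠ none) ∧
  (∀ (p : Pos) (l : Label F K), t p = some l →
    ∀ j : ℕ, (t (p ++ [j]) ≠ none ↔ 1 ≤ j ∧ j ≤ Label.arity ar l))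

def subtree {F K : Type} (t : PTree F K) (p : Pos) : PTree F K := fun q => t (p ++ q)

def loopTree {F K : Type} : PTree F K := fun p => if p = [] then some Label.loop else none

/-- A relation `R` is compatible with the coinductive characterization of refinement. -/
def RefineCompat {F K : Type} (ar : F → ℕ) (R : PTree F K → PTree F K → Prop) : Prop :=
  ∀ t₁ t₂, R t₁ t₂ →
    t₁ = loopTree ∨
    ∃ l : Label F K, l ≠ Label.loop ∧ t₁ [] = some l ∧ t₂ [] = some l ∧
      ∀ i : ℕ, 1 ≤ i → i ≤ Label.arity ar l → R (subtree t₁ [i]) (subtree t₂ [i])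

/-- The refinement relation `⊑_T`: the largest relation compatible with the
coinductive characterization. -/
def Refine {F K : Type} (ar : F → ℕ) (t₁ t₂ : PTree F K) : Prop :=
  ∃ R, RefineCompat ar R ∧ R t₁ t₂

/-- `s` is the supremum (w.r.t. `⊑_T`) of the ω-chain `c` of possibly-infinite trees. -/
def IsSupTree {F K : Type} (ar : F → ℕ) (c : ℕ → PTree F K) (s : PTree F K) : Prop :=
  (∀ i, Refine ar (c i) s) ∧ ∀ u, IsTree ar u → (∀ i, Refine ar (c i) u) → Refine ar s u

/-- The approximating sequence `h_i` of the coinductively defined function determined by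
`base` (on arity-0 labels) and `ind` (on symbols of positive arity). -/
def hseq {F K D : Type} [PartialOrder D] [OrderBot D] (ar : F → ℕ)
    (base : Label F K → D) (ind : (f : F) → (Fin (ar f) → D) → D) :
    ℕ → PTree F K → D
  | 0, _ => ⊥
  | i + 1, t =>
    match t [] with
    | none => ⊥
    | some Label.loop => ⊥
    | some (Label.var k) => base (Label.var k)
    | some (Label.sym f) =>
        if ar f = 0 then base (Label.sym f)
        else ind f (fun j => hseq ar base ind i (subtree t [(j : ℕ) + 1]))

/-- `g : Dⁿ → D` is ω-continuous: monotone and preserving suprema of ω-chains. -/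
def IndCont {D : Type} [PartialOrder D] (n : ℕ) (g : (Fin n → D) → D) : Prop :=
  (∀ v w : Fin n → D, v ≤ w → g v ≤ g w) ∧
  ∀ c : ℕ → Fin n → D, (∀ i, c i ≤ c (i + 1)) →
    ∀ s : Fin n → D, (∀ j, IsLUB (Set.range fun i => c i j) (s j)) →
      IsLUB (Set.range fun i => g (c i)) (g s)

section Refinement

variable {F K : Type} {ar : F → ℕ}

theorem refineCompat_refine : RefineCompat (K := K) ar (Refine ar) := by
  rintro t₁ t₂ ⟨R, hR, h12⟩
  rcases hR t₁ t₂ h12 with h | ⟨l, hl, h1, h2, hs⟩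
  · exact Or.inl h
  · exact Or.inr ⟨l, hl, h1, h2, fun i hi hi' => ⟨R, hR, hs i hi hi'⟩⟩

theorem refine_loopTree (t : PTree F K) : Refine ar loopTree t :=
  ⟨fun a _ => a = loopTree, fun _ _ h => Or.inl h, rfl⟩

theorem refine_of_root {t₁ t₂ : PTree F K} {l : Label F K} (hl : l ≠ Label.loop)
    (h1 : t₁ [] = some l) (h2 : t₂ [] = some l)
    (hs : ∀ i : ℕ, 1 ≤ i → i ≤ Label.arity ar l →
      Refine ar (subtree t₁ [i]) (subtree t₂ [i])) :
    Refine ar t₁ t₂ := by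
  refine ⟨fun a b => Refine ar a b ∨ (a = t₁ ∧ b = t₂), ?_, Or.inr ⟨rfl, rfl⟩⟩
  rintro a b (hab | ⟨rfl, rfl⟩)
  · rcases refineCompat_refine a b hab with h | ⟨l, hl, h1, h2, hs⟩
    · exact Or.inl h
    · exact Or.inr ⟨l, hl, h1, h2, fun i hi hi' => Or.inl (hs i hi hi')⟩
  · exact Or.inr ⟨l, hl, h1, h2, fun i hi hi' => Or.inl (hs i hi hi')⟩

/-- Inversion of refinement when the root of the smaller tree is a proper label. -/
theorem Refine.of_root_left {t₁ t₂ : PTree F K} (h : Refine ar t₁ t₂) {l : Label F K}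
    (hl : l ≠ Label.loop) (h1 : t₁ [] = some l) :
    t₂ [] = some l ∧ ∀ i : ℕ, 1 ≤ i → i ≤ Label.arity ar l →
      Refine ar (subtree t₁ [i]) (subtree t₂ [i]) := by
  rcases refineCompat_refine t₁ t₂ h with rfl | ⟨l', _, h1', h2, hs⟩
  · simp only [loopTree, if_true, Option.some.injEq] at h1
    exact absurd h1.symm hl
  · obtain rfl : l = l' := Option.some.inj (h1.symm.trans h1')
    exact ⟨h2, hs⟩

/-- Refinement when the root of the larger tree is known: the smaller tree is `↺` or has the
same root. -/
theorem Refine.of_root_right {t₁ t₂ : PTree F K} (h : Refine ar t₁ t₂) {l : Label F K}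
    (h2 : t₂ [] = some l) : t₁ = loopTree ∨ t₁ [] = some l := by
  rcases refineCompat_refine t₁ t₂ h with h | ⟨l', _, h1, h2', _⟩
  · exact Or.inl h
  · exact Or.inr (h1.trans (h2'.symm.trans h2))

theorem isTree_loopTree : IsTree (K := K) ar loopTree := by
  refine ⟨by simp [loopTree], fun p j h => by simp [loopTree] at h, ?_⟩
  intro p l hp j
  by_cases hp0 : p = []
  · subst hp0
    simp only [loopTree, if_true, Option.some.injEq] at hp
    subst hp
    simp only [loopTree, Label.arity]
    simp
    omega
  · simp [loopTree, hp0] at hp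

theorem IsTree.subtree {t : PTree F K} (ht : IsTree ar t) {l : Label F K}
    (hl : t [] = some l) {j : ℕ} (hj : 1 ≤ j) (hj' : j ≤ Label.arity ar l) :
    IsTree ar (subtree t [j]) :=
  ⟨(ht.2.2 [] l hl j).2 ⟨hj, hj'⟩, fun p i => ht.2.1 (j :: p) i,
    fun p l => ht.2.2 (j :: p) l⟩

/-- Replace the `j`-th child of `t` by `u`. -/
def replaceChild (t : PTree F K) (j : ℕ) (u : PTree F K) : PTree F K
  | [] => t []
  | k :: q => if k = j then u q else t (k :: q)

theorem subtree_replaceChild_self (t : PTree F K) (j : ℕ) (u : PTree F K) :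
    subtree (replaceChild t j u) [j] = u := by
  funext q
  simp [subtree, replaceChild]

theorem subtree_replaceChild_of_ne (t : PTree F K) {j k : ℕ} (hk : k ≠ j) (u : PTree F K) :
    subtree (replaceChild t j u) [k] = subtree t [k] := by
  funext q
  simp [subtree, replaceChild, hk]

theorem IsTree.replaceChild {t u : PTree F K} (ht : IsTree ar t) (hu : IsTree ar u)
    {l : Label F K} (hl : t [] = some l) {j : ℕ} (hj : 1 ≤ j) (hj' : j ≤ Label.arity ar l) :
    IsTree ar (replaceChild t j u) := by
  refine ⟨ht.1, ?_, ?_⟩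
  · rintro (_ | ⟨k, q⟩) i h
    · exact ht.1
    · by_cases hk : k = j
      · simp only [_root_.replaceChild, List.cons_append, if_pos hk] at h ⊢
        exact hu.2.1 q i h
      · simp only [_root_.replaceChild, List.cons_append, if_neg hk] at h ⊢
        exact ht.2.1 (k :: q) i h
  · rintro (_ | ⟨k, q⟩) m hm i
    · obtain rfl : l = m := Option.some.inj (hl.symm.trans hm)
      by_cases hi : i = j
      · subst hi
        simp only [_root_.replaceChild, List.nil_append, if_true]
        exact iff_of_true hu.1 ⟨hj, hj'⟩
      · simp only [_root_.replaceChild, List.nil_append, if_neg hi]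
        exact ht.2.2 [] l hl i
    · by_cases hk : k = j
      · simp only [_root_.replaceChild, List.cons_append, if_pos hk] at hm ⊢
        exact hu.2.2 q m hm i
      · simp only [_root_.replaceChild, List.cons_append, if_neg hk] at hm ⊢
        exact ht.2.2 (k :: q) m hm i

/-- A proper root label of the supremum is attained in the chain, `↺` preceding its first
occurrence. -/
theorem IsSupTree.exists_root_eq {c : ℕ → PTree F K} {s : PTree F K}
    (hs : IsSupTree ar c s) {l : Label F K} (hl : l ≠ Label.loop) (hsl : s [] = some l) :
    ∃ N, c N [] = some l ∧ ∀ i < N, c i = loopTree := by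
  classical
  have hex : ∃ N, c N [] = some l := by
    by_contra! hno
    have hloop : Refine ar s loopTree := hs.2 _ isTree_loopTree fun i => by
      rw [((hs.1 i).of_root_right hsl).resolve_right (hno i)]
      exact refine_loopTree _
    have := (hloop.of_root_left hl hsl).1
    simp only [loopTree, if_true, Option.some.injEq] at this
    exact hl this.symm
  exact ⟨Nat.find hex, Nat.find_spec hex, fun i hi =>
    ((hs.1 i).of_root_right hsl).resolve_right (Nat.find_min hex hi)⟩

theorem root_eq_of_chain {c : ℕ → PTree F K} (hc : ∀ i, Refine ar (c i) (c (i + 1)))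
    {l : Label F K} (hl : l ≠ Label.loop) {N : ℕ} (hN : c N [] = some l) (i : ℕ) :
    c (N + i) [] = some l := by
  induction i with
  | zero => exact hN
  | succ i ih => exact ((hc (N + i)).of_root_left hl ih).1

/-- Suprema of chains are computed childwise. -/
theorem IsSupTree.subtree {c : ℕ → PTree F K} {s : PTree F K} (hs : IsSupTree ar c s)
    (hst : IsTree ar s) (hc : ∀ i, Refine ar (c i) (c (i + 1))) {l : Label F K}
    (hl : l ≠ Label.loop) (hsl : s [] = some l) {N : ℕ} (hN : c N [] = some l)
    (hlt : ∀ i < N, c i = loopTree) {j : ℕ} (hj : 1 ≤ j) (hj' : j ≤ Label.arity ar l) :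
    IsSupTree ar (fun i => subtree (c (N + i)) [j]) (subtree s [j]) := by
  have hroot := root_eq_of_chain hc hl hN
  refine ⟨fun i => ((hs.1 (N + i)).of_root_left hl (hroot i)).2 j hj hj', fun u hu hub => ?_⟩
  have hle : Refine ar s (replaceChild s j u) := by
    refine hs.2 _ (hst.replaceChild hu hsl hj hj') fun i => ?_
    rcases lt_or_ge i N with hi | hi
    · rw [hlt i hi]
      exact refine_loopTree _
    · obtain ⟨m, rfl⟩ := Nat.exists_eq_add_of_le hi
      refine refine_of_root hl (hroot m) hsl fun k hk hk' => ?_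
      by_cases hkj : k = j
      · subst hkj
        rw [subtree_replaceChild_self]
        exact hub m
      · rw [subtree_replaceChild_of_ne s hkj]
        exact ((hs.1 (N + m)).of_root_left hl (hroot m)).2 k hk hk'
  simpa only [subtree_replaceChild_self] using (hle.of_root_left hl hsl).2 j hj hj'

end Refinement

section Approximation

variable {F K D : Type} [PartialOrder D] [OrderBot D] {ar : F → ℕ}
  {base : Label F K → D} {ind : (f : F) → (Fin (ar f) → D) → D}

theorem hseq_loopTree (n : ℕ) : hseq ar base ind n loopTree = ⊥ := by
  cases n <;> simp [hseq, loopTree]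

theorem hseq_mono_of_refine (hind : ∀ f, Monotone (ind f)) (n : ℕ) {t₁ t₂ : PTree F K}
    (h : Refine ar t₁ t₂) : hseq ar base ind n t₁ ≤ hseq ar base ind n t₂ := by
  induction n generalizing t₁ t₂ with
  | zero => exact le_rfl
  | succ n ih =>
    rcases refineCompat_refine t₁ t₂ h with rfl | ⟨l, hl, h1, h2, hs⟩
    · rw [hseq_loopTree]
      exact bot_le
    · rcases l with f | k | _
      · simp only [hseq, h1, h2]
        split_ifs
        · exact le_rfl
        · exact hind f fun j => ih (hs _ (Nat.succ_pos _) j.isLt)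
      · simp only [hseq, h1, h2, le_refl]
      · exact absurd rfl hl

/-- Each approximation at the supremum of a chain is attained along the chain. -/
theorem exists_hseq_sup_le (hind : ∀ f, Monotone (ind f)) (n : ℕ) {c : ℕ → PTree F K}
    {s : PTree F K} (hst : IsTree ar s) (hc : ∀ i, Refine ar (c i) (c (i + 1)))
    (hs : IsSupTree ar c s) :
    ∃ N, hseq ar base ind n s ≤ hseq ar base ind n (c N) := by
  induction n generalizing c s with
  | zero => exact ⟨0, le_rfl⟩
  | succ n ih =>
    rcases hsl : s [] with _ | l
    · exact absurd hsl hst.1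
    by_cases hl : l = Label.loop
    · exact ⟨0, by simp [hseq, hsl, hl]⟩
    obtain ⟨N, hN, hlt⟩ := hs.exists_root_eq hl hsl
    have hroot := root_eq_of_chain hc hl hN
    rcases l with f | k | _
    · have hchild (j : Fin (ar f)) (i : ℕ) :
          Refine ar (subtree (c (N + i)) [(j : ℕ) + 1])
            (subtree (c (N + (i + 1))) [(j : ℕ) + 1]) :=
        ((hc (N + i)).of_root_left hl (hroot i)).2 _ (Nat.succ_pos _) j.isLt
      have hM (j : Fin (ar f)) := ih (hst.subtree hsl (Nat.succ_pos _) j.isLt) (hchild j)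
        (hs.subtree hst hc hl hsl hN hlt (Nat.succ_pos _) j.isLt)
      choose M hM using hM
      refine ⟨N + Finset.univ.sup M, ?_⟩
      simp only [hseq, hsl, hroot]
      split_ifs
      · exact le_rfl
      · refine hind f fun j => (hM j).trans ?_
        exact monotone_nat_of_le_succ
          (f := fun i => hseq ar base ind n (subtree (c (N + i)) [(j : ℕ) + 1]))
          (fun i => hseq_mono_of_refine hind n (hchild j i))
          (Finset.le_sup (Finset.mem_univ j))
    · exact ⟨N, by simp only [hseq, hsl, hN, le_refl]⟩
    · exact absurd rfl hl

end Approximation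

/-- The coinductively defined function `h := ⊔_{i≥0} h_i : Tree^∞(F,K) → D` into an
ω-cpo `D` with least element `⊥` satisfies `h(↺) = ⊥` and is ω-continuous w.r.t.
`⊑_T` and `⊑_D`: it is monotone and maps suprema of ω-chains of trees to suprema. -/
theorem coinductive_fun_continuous {F K D : Type} [Nonempty F]
    [PartialOrder D] [OrderBot D] (ar : F → ℕ)
    (hD : ∀ c : ℕ → D, (∀ i, c i ≤ c (i + 1)) → ∃ s, IsLUB (Set.range c) s)
    (base : Label F K → D) (ind : (f : F) → (Fin (ar f) → D) → D)
    (hind : ∀ f : F, IndCont (ar f) (ind f))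
    (h : PTree F K → D)
    (hh : ∀ t : PTree F K, IsLUB (Set.range fun i => hseq ar base ind i t) (h t)) :
    h loopTree = ⊥ ∧
    (∀ t₁ t₂ : PTree F K, IsTree ar t₁ → IsTree ar t₂ → Refine ar t₁ t₂ → h t₁ ≤ h t₂) ∧
    (∀ c : ℕ → PTree F K, (∀ i, IsTree ar (c i)) → (∀ i, Refine ar (c i) (c (i + 1))) →
      ∀ s : PTree F K, IsTree ar s → IsSupTree ar c s →
        IsLUB (Set.range fun i => h (c i)) (h s)) := by
  have hmono : ∀ f, Monotone (ind f) := fun f v w => (hind f).1 v w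
  have hle : ∀ t₁ t₂ : PTree F K, Refine ar t₁ t₂ → h t₁ ≤ h t₂ := by
    intro t₁ t₂ h12
    refine (hh t₁).2 ?_
    rintro _ ⟨n, rfl⟩
    exact (hseq_mono_of_refine hmono n h12).trans ((hh t₂).1 ⟨n, rfl⟩)
  refine ⟨?_, fun t₁ t₂ _ _ => hle t₁ t₂, fun c _ hc s hst hs => ⟨?_, fun b hb => ?_⟩⟩
  · refine le_bot_iff.1 ((hh loopTree).2 ?_)
    rintro _ ⟨n, rfl⟩
    exact (hseq_loopTree n).le
  · rintro _ ⟨i, rfl⟩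
    exact hle _ _ (hs.1 i)
  · refine (hh s).2 ?_
    rintro _ ⟨n, rfl⟩
    obtain ⟨N, hN⟩ := exists_hseq_sup_le hmono n hst hc hs
    exact (hN.trans ((hh (c N)).1 ⟨n, rfl⟩)).trans (hb ⟨N, rfl⟩)
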